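/- Set a = 1/(12e) and b = 1/(1440e), and define z_n = ln(n!) − ln(√(2π)) − (1/2)·ln n − n·ln(n/e + a/n + b/n³) for n ≥ 1. Then lim_{n→∞} n⁵·z_n = 239/362880; in particular the rate of convergence of (z_n) to zero is n^{−5}. -/

import Mathlib

open Filter Topology Real

/-- The first terms of the Stirling series for `log (stirlingSeq n)`, up to an additive constant. -/
noncomputable def stirlingSeries (x : ℝ) : ℝ :=
  1 / (12 * x) - 1 / (360 * x ^ 3) + 1 / (1260 * x ^ 5)

lemma abs_mul_le_of_nonneg_left {c x y : ℝ} (hc : 0 ≤ c) (h : |x| ≤ y) : |c * x| ≤ c * y := by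
  rw [abs_mul, abs_of_nonneg hc]
  exact mul_le_mul_of_nonneg_left h hc

lemma tendsto_one_div_nat_succ_pow (k : ℕ) (hk : k ≠ 0) :
    Tendsto (fun m : ℕ => 1 / ((m : ℝ) + 1) ^ k) atTop (𝓝 0) := by
  have h := (tendsto_one_div_add_atTop_nhds_zero_nat (𝕜 := ℝ)).pow k
  simpa [hk] using h

lemma log_stirlingSeq_sdiff_eq (m : ℕ) :
    Real.log (Stirling.stirlingSeq (m + 1)) - Real.log (Stirling.stirlingSeq (m + 2)) =
      ((m : ℝ) + 3 / 2) * Real.log (((m : ℝ) + 2) / (m + 1)) - 1 := by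
  simp (disch := positivity) only [Stirling.log_stirlingSeq_formula, Real.log_div, Real.log_mul,
    Real.log_exp, Nat.factorial_succ, Nat.cast_mul, Nat.cast_succ]
  rw [show (m : ℝ) + 1 + 1 = m + 2 by ring]
  ring

lemma abs_log_stirlingSeq_sdiff_sub_le (m : ℕ) :
    |Real.log (Stirling.stirlingSeq (m + 1)) - Real.log (Stirling.stirlingSeq (m + 2)) -
        (1 / (3 * (2 * (m : ℝ) + 3) ^ 2) + 1 / (5 * (2 * (m : ℝ) + 3) ^ 4) +
          1 / (7 * (2 * (m : ℝ) + 3) ^ 6))| ≤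
      1 / (4 * (2 * (m : ℝ) + 3) ^ 6 * (m + 1) * (m + 2)) := by
  rw [log_stirlingSeq_sdiff_eq]
  have hm : (0 : ℝ) ≤ m := m.cast_nonneg
  set t : ℝ := 1 / (2 * (m : ℝ) + 3) with ht
  have ht0 : 0 < t := by positivity
  have ht1 : t < 1 := by
    rw [ht, div_lt_one (by positivity)]; linarith
  have h := Real.sum_range_sub_log_div_le (x := t) (by rwa [abs_of_pos ht0]) 4
  have hq : (1 + t) / (1 - t) = ((m : ℝ) + 2) / (m + 1) := by
    rw [div_eq_div_iff (by linarith) (by positivity), ht]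
    field_simp
    ring
  have hden : 1 - t ^ 2 = 4 * ((m : ℝ) + 1) * (m + 2) * t ^ 2 := by
    rw [ht]
    field_simp
    ring
  rw [hq, hden, abs_of_pos ht0] at h
  simp only [Finset.sum_range_succ, Finset.sum_range_zero] at h
  set L := Real.log (((m : ℝ) + 2) / (m + 1))
  have h' := abs_mul_le_of_nonneg_left (show 0 ≤ 2 * (m : ℝ) + 3 by positivity) h
  refine le_of_eq_of_le (congrArg abs ?_) (h'.trans_eq ?_)
  · rw [ht]
    push_cast
    field_simp
    ring
  · rw [ht, show 2 * 4 + 1 = 9 from rfl]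
    field_simp

lemma abs_log_stirlingSeq_sub_stirlingSeries_sdiff_le (m : ℕ) :
    |(Real.log (Stirling.stirlingSeq (m + 1)) - stirlingSeries (m + 1)) -
        (Real.log (Stirling.stirlingSeq (m + 2)) - stirlingSeries (m + 2))| ≤
      1 / ((m : ℝ) + 1) ^ 6 - 1 / ((m : ℝ) + 2) ^ 6 := by
  have h := abs_le.1 (abs_log_stirlingSeq_sdiff_sub_le m)
  have h1 : 0 ≤ 1 / ((m : ℝ) + 1) ^ 6 - 1 / ((m : ℝ) + 2) ^ 6
      - 1 / (4 * (2 * (m : ℝ) + 3) ^ 6 * (m + 1) * (m + 2))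
      - (1 / (3 * (2 * (m : ℝ) + 3) ^ 2) + 1 / (5 * (2 * (m : ℝ) + 3) ^ 4) +
          1 / (7 * (2 * (m : ℝ) + 3) ^ 6))
      + (stirlingSeries (m + 1) - stirlingSeries (m + 2)) := by
    unfold stirlingSeries
    field_simp
    ring_nf
    positivity
  have h2 : 0 ≤ 1 / ((m : ℝ) + 1) ^ 6 - 1 / ((m : ℝ) + 2) ^ 6
      - 1 / (4 * (2 * (m : ℝ) + 3) ^ 6 * (m + 1) * (m + 2))
      + (1 / (3 * (2 * (m : ℝ) + 3) ^ 2) + 1 / (5 * (2 * (m : ℝ) + 3) ^ 4) +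
          1 / (7 * (2 * (m : ℝ) + 3) ^ 6))
      - (stirlingSeries (m + 1) - stirlingSeries (m + 2)) := by
    unfold stirlingSeries
    field_simp
    ring_nf
    positivity
  rw [abs_le]
  constructor <;> linarith [h.1, h.2]

lemma tendsto_log_stirlingSeq_sub_stirlingSeries :
    Tendsto (fun m : ℕ => Real.log (Stirling.stirlingSeq (m + 1)) - stirlingSeries (m + 1))
      atTop (𝓝 (Real.log √π)) := by
  have h1 : Tendsto (fun m : ℕ => Real.log (Stirling.stirlingSeq (m + 1))) atTop
      (𝓝 (Real.log √π)) :=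
    (Stirling.tendsto_stirlingSeq_sqrt_pi.comp (tendsto_add_atTop_nat 1)).log (by positivity)
  have h2 : Tendsto (fun m : ℕ => stirlingSeries (m + 1)) atTop (𝓝 0) := by
    have h := (((tendsto_one_div_nat_succ_pow 1 (by simp)).const_mul (1 / 12)).sub
      ((tendsto_one_div_nat_succ_pow 3 (by simp)).const_mul (1 / 360))).add
      ((tendsto_one_div_nat_succ_pow 5 (by simp)).const_mul (1 / 1260))
    simp only [mul_zero, sub_zero, add_zero] at h
    refine h.congr fun m => ?_
    unfold stirlingSeries
    field_simp
  simpa using h1.sub h2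

lemma abs_log_stirlingSeq_sub_le (m : ℕ) :
    |Real.log (Stirling.stirlingSeq (m + 1)) - stirlingSeries (m + 1) - Real.log √π| ≤
      1 / ((m : ℝ) + 1) ^ 6 := by
  have hd := fun k => abs_le.1 (abs_log_stirlingSeq_sub_stirlingSeries_sdiff_le k)
  have hanti : Antitone fun k : ℕ =>
      Real.log (Stirling.stirlingSeq (k + 1)) - stirlingSeries (k + 1) + 1 / ((k : ℝ) + 1) ^ 6 := by
    refine antitone_nat_of_succ_le fun k => ?_
    push_cast
    rw [show (k : ℝ) + 1 + 1 = k + 2 by ring]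
    linarith [(hd k).1]
  have hmono : Monotone fun k : ℕ =>
      Real.log (Stirling.stirlingSeq (k + 1)) - stirlingSeries (k + 1) - 1 / ((k : ℝ) + 1) ^ 6 := by
    refine monotone_nat_of_le_succ fun k => ?_
    push_cast
    rw [show (k : ℝ) + 1 + 1 = k + 2 by ring]
    linarith [(hd k).2]
  have h6 := tendsto_one_div_nat_succ_pow 6 (by simp)
  have hlo := hanti.le_of_tendsto (tendsto_log_stirlingSeq_sub_stirlingSeries.add h6) m
  have hhi := hmono.ge_of_tendsto (tendsto_log_stirlingSeq_sub_stirlingSeries.sub h6) m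
  rw [abs_le]
  constructor <;> linarith

lemma abs_log_one_add_sub_le {x : ℝ} (hx0 : 0 ≤ x) (hx1 : x ≤ 1) :
    |Real.log (1 + (x ^ 2 / 12 + x ^ 4 / 1440)) -
        (x ^ 2 / 12 - x ^ 4 / 360 + 7 * x ^ 6 / 51840)| ≤ x ^ 7 := by
  set u : ℝ := x ^ 2 / 12 + x ^ 4 / 1440 with hu
  have h42 : x ^ 4 ≤ x ^ 2 := pow_le_pow_of_le_one hx0 hx1 (by norm_num)
  have h2 : x ^ 2 ≤ 1 := pow_le_one₀ hx0 hx1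
  have hu0 : 0 ≤ u := by positivity
  have hu1 : u ≤ x ^ 2 / 6 := by linarith
  have h := Real.abs_log_sub_add_sum_range_le (x := -u) (by
    rw [abs_neg, abs_of_nonneg hu0]; linarith) 3
  rw [abs_neg, abs_of_nonneg hu0, sub_neg_eq_add] at h
  have hb : u ^ (3 + 1) / (1 - u) ≤ x ^ 8 / 2 := by
    rw [div_le_iff₀ (by linarith)]
    have := pow_le_pow_left₀ hu0 hu1 4
    have h8 : 0 ≤ x ^ 8 := by positivity
    nlinarith
  have hpoly : u - u ^ 2 / 2 + u ^ 3 / 3 = (x ^ 2 / 12 - x ^ 4 / 360 + 7 * x ^ 6 / 51840) +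
      x ^ 8 * (-1 / 4147200 + 1 / 207360 + x ^ 2 / 24883200 + x ^ 4 / 8957952000) := by
    rw [hu]; ring
  have h87 : x ^ 8 ≤ x ^ 7 := pow_le_pow_of_le_one hx0 hx1 (by norm_num)
  have h8 : 0 ≤ x ^ 8 := by positivity
  simp only [Finset.sum_range_succ, Finset.sum_range_zero] at h
  have hh := abs_le.1 (h.trans hb)
  norm_num at hh
  have hr0 : 0 ≤ x ^ 8 * (-1 / 4147200 + 1 / 207360 + x ^ 2 / 24883200 + x ^ 4 / 8957952000) :=
    mul_nonneg h8 (by linarith [sq_nonneg x, sq_nonneg (x ^ 2), pow_nonneg hx0 4])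
  have hr1 : x ^ 8 * (-1 / 4147200 + 1 / 207360 + x ^ 2 / 24883200 + x ^ 4 / 8957952000) ≤
      x ^ 8 * (1 / 2) :=
    mul_le_mul_of_nonneg_left (by linarith) h8
  rw [abs_le]
  constructor <;> nlinarith [hh.1, hh.2]

/-- Theorem 2.1 (iii): with `a = 1/(12e)` and `b = 1/(1440e)`,
`n⁵ * z n → 239/362880`, so the rate of convergence of `z n` to zero
is `n⁻⁵`. -/
theorem tendsto_pow_five_mul_z
    (z : ℕ → ℝ)
    (hz : ∀ n : ℕ, 1 ≤ n →
      z n = Real.log (Nat.factorial n) - Real.log (Real.sqrt (2 * π))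
        - (1 / 2) * Real.log n
        - n * Real.log ((n : ℝ) / Real.exp 1 + (1 / (12 * Real.exp 1)) / n
            + (1 / (1440 * Real.exp 1)) / (n : ℝ) ^ 3)) :
    Tendsto (fun n : ℕ => (n : ℝ) ^ 5 * z n) atTop (𝓝 (239 / 362880)) := by
  rw [← tendsto_add_atTop_iff_nat 1, tendsto_iff_norm_sub_tendsto_zero]
  have h0 := (tendsto_one_div_add_atTop_nhds_zero_nat (𝕜 := ℝ)).const_mul 2
  rw [mul_zero] at h0
  refine squeeze_zero (fun _ => norm_nonneg _) (fun m => ?_) h0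
  have hs := abs_log_stirlingSeq_sub_le m
  rw [hz (m + 1) (by simp), Real.norm_eq_abs]
  rw [Stirling.log_stirlingSeq_formula] at hs
  push_cast at hs ⊢
  set N : ℝ := (m : ℝ) + 1 with hN
  have hN0 : 0 < N := by positivity
  have hN1 : 1 ≤ N := by rw [hN]; linarith [(m.cast_nonneg : (0 : ℝ) ≤ m)]
  have hl := abs_log_one_add_sub_le (x := 1 / N) (by positivity) (by
    rw [div_le_one hN0]; exact hN1)
  set u : ℝ := (1 / N) ^ 2 / 12 + (1 / N) ^ 4 / 1440 with hu
  have hu0 : 0 ≤ u := by positivity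
  have hfac : N / Real.exp 1 + 1 / (12 * Real.exp 1) / N + 1 / (1440 * Real.exp 1) / N ^ 3 =
      N / Real.exp 1 * (1 + u) := by
    rw [hu]; field_simp; ring
  rw [hfac, Real.log_mul (by positivity) (by positivity), Real.log_sqrt (by positivity),
    Real.log_mul two_ne_zero Real.pi_ne_zero]
  rw [Real.log_sqrt Real.pi_pos.le, Real.log_mul two_ne_zero hN0.ne'] at hs
  set A := Real.log ((m + 1).factorial : ℝ)
  set B := Real.log (N / Real.exp 1)
  set C := Real.log (1 + u)
  have hs5 := abs_mul_le_of_nonneg_left (show 0 ≤ N ^ 5 by positivity) hs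
  have hl6 := abs_mul_le_of_nonneg_left (show 0 ≤ N ^ 6 by positivity) hl
  have e5 : N ^ 5 * (1 / N ^ 6) = 1 / N := by field_simp
  have e6 : N ^ 6 * (1 / N) ^ 7 = 1 / N := by field_simp
  rw [e5] at hs5
  rw [e6] at hl6
  have key := (abs_sub _ _).trans (add_le_add hs5 hl6)
  rw [two_mul]
  refine le_trans (le_of_eq ?_) key
  congr 1
  unfold stirlingSeries
  field_simp
  ring
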